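/- arXiv:2506.11900 — 2 statements merged into one kernel-verified Lean document; each statement's English description precedes it below -/
import Mathlib

section
/- Shifted deterministic sewing lemma. Let E be a Banach space and 𝒮 ≤ 𝒯 be real numbers. Let A be an E-valued function on the simplex {(s,t) : 𝒮 ≤ s ≤ t ≤ 𝒯}. Suppose there exist control functions w₁, w₂ on [𝒮,𝒯] and nonnegative real parameters α₁, α₂, β₁, β₂ with β₁ > 0, β₂ > 0 and α₂ + β₂ > 1 such that: (i) ‖A_{s,t}‖_E ≤ w₁(s−(t−s), t)^{α₁} (t−s)^{β₁} for all 𝒮 ≤ s ≤ t ≤ 𝒯 with s−(t−s) ≥ 𝒮; and (ii) ‖A_{s,t} − A_{s,u} − A_{u,t}‖_E ≤ w₂(s−(t−s), t)^{α₂} (t−s)^{β₂} for all 𝒮 ≤ s ≤ u ≤ t ≤ 𝒯 with s−(t−s) ≥ 𝒮 and min(u−s, t−u) ≥ (t−s)/3. Assume further that there exists a continuous map 𝒜 : [𝒮,𝒯] → E such that for every t ∈ [𝒮,𝒯] and every sequence of partitions Π_k = {𝒮 = t₀ᵏ < t₁ᵏ < ⋯ < t_{N_k}ᵏ = t} of [𝒮,t]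 whose mesh tends to zero, the Riemann sums Σ_{i=0}^{N_k−1} A_{t_iᵏ, t_{i+1}ᵏ} converge in E to 𝒜_t − 𝒜_𝒮. Then there exist constants C₁, C₂, C₃ > 0, depending only on α₁, α₂, β₁, β₂, such that: (1) ‖𝒜_t − 𝒜_s − A_{s,t}‖_E ≤ C₁ w₂(s−(t−s), t)^{α₂} (t−s)^{β₂} for all 𝒮 ≤ s ≤ t ≤ 𝒯 with s−(t−s) ≥ 𝒮; and (2) ‖𝒜_t − 𝒜_s‖_E ≤ C₂ w₁(s,t)^{α₁} (t−s)^{β₁} + C₃ w₂(s,t)^{α₂} (t−s)^{β₂} for all 𝒮 ≤ s ≤ t ≤ 𝒯. -/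
open Filter

/-- A control function on the interval `[S, T]`: continuous on the simplex,
nonnegative, vanishing on the diagonal, and superadditive. -/
def IsControl (S T : ℝ) (w : ℝ → ℝ → ℝ) : Prop :=
  ContinuousOn (fun p : ℝ × ℝ => w p.1 p.2) {p : ℝ × ℝ | S ≤ p.1 ∧ p.1 ≤ p.2 ∧ p.2 ≤ T} ∧
  (∀ s t, S ≤ s → s ≤ t → t ≤ T → 0 ≤ w s t) ∧
  (∀ s, S ≤ s → s ≤ T → w s s = 0) ∧
  (∀ s u t, S ≤ s → s ≤ u → u ≤ t → t ≤ T → w s u + w u t ≤ w s t)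

theorem Finset.sum_range_two_mul_eq {M : Type*} [AddCommMonoid M] (f : ℕ → M) (N : ℕ) :
    ∑ i ∈ Finset.range (2 * N), f i = ∑ i ∈ Finset.range N, (f (2 * i) + f (2 * i + 1)) := by
  induction N with
  | zero => simp
  | succ N ih =>
    rw [show 2 * (N + 1) = 2 * N + 1 + 1 by ring, Finset.sum_range_succ, Finset.sum_range_succ,
      Finset.sum_range_succ, ih, add_assoc]

/-- A bound on sums of powers of nonnegative reals which are at most `W` and have sum at most
`2 * W`. -/
theorem sum_rpow_le_of_sum_le_two_mul {N : ℕ} (hN : 0 < N) {x : ℕ → ℝ} {W α γ : ℝ}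
    (hγ : 0 ≤ γ) (hγ' : γ ≤ 1) (hγα : γ ≤ α) (hx : ∀ i < N, 0 ≤ x i) (hxW : ∀ i < N, x i ≤ W)
    (hsum : ∑ i ∈ Finset.range N, x i ≤ 2 * W) :
    ∑ i ∈ Finset.range N, x i ^ α ≤ 2 * (N : ℝ) ^ (1 - γ) * W ^ α := by
  have hN' : (0 : ℝ) < N := by exact_mod_cast hN
  have hW : 0 ≤ W := (hx 0 hN).trans (hxW 0 hN)
  have hα : ∀ y : ℝ, 0 ≤ y → y ^ α = y ^ (α - γ) * y ^ γ := fun y hy => by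
    rw [← Real.rpow_add_of_nonneg hy (by linarith) hγ, sub_add_cancel]
  have hjensen : ∑ i ∈ Finset.range N, (N : ℝ)⁻¹ • x i ^ γ
      ≤ (∑ i ∈ Finset.range N, (N : ℝ)⁻¹ • x i) ^ γ :=
    (Real.concaveOn_rpow hγ hγ').le_map_sum (fun _ _ => by positivity)
      (by simp [hN'.ne']) (fun i hi => hx i (Finset.mem_range.1 hi))
  simp only [smul_eq_mul, ← Finset.mul_sum] at hjensen
  have hmean : ∑ i ∈ Finset.range N, x i ^ γ ≤ 2 * (N : ℝ) ^ (1 - γ) * W ^ γ := by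
    have hsum0 : 0 ≤ ∑ i ∈ Finset.range N, x i :=
      Finset.sum_nonneg fun i hi => hx i (Finset.mem_range.1 hi)
    calc ∑ i ∈ Finset.range N, x i ^ γ
        = N * ((N : ℝ)⁻¹ * ∑ i ∈ Finset.range N, x i ^ γ) := by field_simp
      _ ≤ N * ((N : ℝ)⁻¹ * (2 * W)) ^ γ := by
          refine mul_le_mul_of_nonneg_left (hjensen.trans ?_) hN'.le
          gcongr
      _ = (2 : ℝ) ^ γ * (N : ℝ) ^ (1 - γ) * W ^ γ := by
          rw [Real.mul_rpow (by positivity) (by positivity), Real.mul_rpow (by norm_num) hW,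
            Real.inv_rpow hN'.le, Real.rpow_sub hN', Real.rpow_one]
          ring
      _ ≤ 2 * (N : ℝ) ^ (1 - γ) * W ^ γ := by
          have h2 : (2 : ℝ) ^ γ ≤ 2 := by
            simpa using Real.rpow_le_rpow_of_exponent_le (by norm_num : (1 : ℝ) ≤ 2) hγ'
          gcongr
  calc ∑ i ∈ Finset.range N, x i ^ α ≤ ∑ i ∈ Finset.range N, W ^ (α - γ) * x i ^ γ := by
        refine Finset.sum_le_sum fun i hi => ?_
        have hi := Finset.mem_range.1 hi
        rw [hα _ (hx i hi)]
        exact mul_le_mul_of_nonneg_right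
          (Real.rpow_le_rpow (hx i hi) (hxW i hi) (by linarith)) (Real.rpow_nonneg (hx i hi) _)
    _ ≤ W ^ (α - γ) * (2 * (N : ℝ) ^ (1 - γ) * W ^ γ) := by
        rw [← Finset.mul_sum]
        exact mul_le_mul_of_nonneg_left hmean (Real.rpow_nonneg hW _)
    _ = 2 * (N : ℝ) ^ (1 - γ) * W ^ α := by rw [hα W hW]; ring

namespace IsControl

variable {S T : ℝ} {w : ℝ → ℝ → ℝ}

theorem nonneg (hw : IsControl S T w) {s t : ℝ} (hs : S ≤ s) (hst : s ≤ t) (ht : t ≤ T) :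
    0 ≤ w s t :=
  hw.2.1 s t hs hst ht

theorem add_le (hw : IsControl S T w) {s u t : ℝ} (hs : S ≤ s) (hsu : s ≤ u) (hut : u ≤ t)
    (ht : t ≤ T) : w s u + w u t ≤ w s t :=
  hw.2.2.2 s u t hs hsu hut ht

theorem mono (hw : IsControl S T w) {s s' t' t : ℝ} (hs : S ≤ s) (hss : s ≤ s') (hst : s' ≤ t')
    (htt : t' ≤ t) (ht : t ≤ T) : w s' t' ≤ w s t := by
  have h₁ := hw.add_le hs hss (hst.trans htt) ht
  have h₂ := hw.add_le (hs.trans hss) hst htt ht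
  have h₃ := hw.nonneg hs hss (by linarith)
  have h₄ := hw.nonneg (by linarith) htt ht
  linarith

/-- Overlapping double increments of a monotone sequence are summed up by a control. -/
theorem sum_double_increment_le (hw : IsControl S T w) {q : ℕ → ℝ} (hq : Monotone q)
    (h0 : S ≤ q 0) (N : ℕ) (hN : q (N + 1) ≤ T) :
    ∑ i ∈ Finset.range N, w (q i) (q (i + 2)) ≤ w (q 0) (q N) + w (q 0) (q (N + 1)) := by
  induction N with
  | zero =>
    have h₁ := hw.nonneg h0 le_rfl ((hq (Nat.zero_le 1)).trans hN)
    have h₂ := hw.nonneg h0 (hq (Nat.zero_le 1)) hN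
    simpa using add_nonneg h₁ h₂
  | succ N ih =>
    have h := hw.add_le h0 (hq (Nat.zero_le N)) (hq (by lia : N ≤ N + 2)) hN
    have ih := ih ((hq (by lia)).trans hN)
    rw [Finset.sum_range_succ]
    linarith

end IsControl

/-- The Riemann sum of `A` along the uniform partition of `[s, t]` into `N` intervals. -/
noncomputable def uniformRiemannSum {E : Type*} [AddCommMonoid E] (A : ℝ → ℝ → E) (s t : ℝ)
    (N : ℕ) : E :=
  ∑ i ∈ Finset.range N, A (s + i * ((t - s) / N)) (s + (i + 1) * ((t - s) / N))

section

variable {E : Type*} [NormedAddCommGroup E] {S T : ℝ} {A : ℝ → ℝ → E} {𝒜 : ℝ → E}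

/-- If Riemann sums along partitions of `[S, t]` converge to the increments of `𝒜`, then so do
the dyadic Riemann sums over `[s, t]`. -/
theorem tendsto_uniformRiemannSum_two_pow
    (hlim : ∀ t ∈ Set.Icc S T, ∀ (N : ℕ → ℕ) (π : ℕ → ℕ → ℝ),
      (∀ k, π k 0 = S) → (∀ k, π k (N k) = t) →
      (∀ k, ∀ i < N k, π k i < π k (i + 1)) →
      (∀ ε > (0:ℝ), ∃ K : ℕ, ∀ k ≥ K, ∀ i < N k, π k (i + 1) - π k i ≤ ε) →
      Tendsto (fun k => ∑ i ∈ Finset.range (N k), A (π k i) (π k (i + 1))) atTop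
        (nhds (𝒜 t - 𝒜 S)))
    {s t : ℝ} (hs : S < s) (hst : s < t) (ht : t ≤ T) :
    Tendsto (fun n : ℕ => uniformRiemannSum A s t (2 ^ n)) atTop (nhds (𝒜 t - 𝒜 s)) := by
  have hmesh : ∀ c : ℝ, ∀ ε > (0 : ℝ), ∃ K : ℕ, ∀ k ≥ K, c / 2 ^ k ≤ ε := fun c ε hε => by
    have h : Tendsto (fun k : ℕ => c / (2 : ℝ) ^ k) atTop (nhds 0) :=
      tendsto_const_nhds.div_atTop (tendsto_pow_atTop_atTop_of_one_lt (by norm_num))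
    obtain ⟨K, hK⟩ := eventually_atTop.1 (h.eventually (gt_mem_nhds hε))
    exact ⟨K, fun k hk => (hK k hk).le⟩
  have hleft := hlim s ⟨hs.le, hst.le.trans ht⟩ (fun k => 2 ^ k)
    (fun k i => S + i * ((s - S) / 2 ^ k)) (by simp)
    (fun k => by push_cast; field_simp; ring)
    (fun k i _ => by
      have : 0 < (s - S) / 2 ^ k := div_pos (by linarith) (by positivity)
      push_cast; linarith)
    (fun ε hε => by
      obtain ⟨K, hK⟩ := hmesh (s - S) ε hε
      refine ⟨K, fun k hk i _ => ?_⟩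
      have := hK k hk
      push_cast; linarith)
  let π : ℕ → ℕ → ℝ := fun k i =>
    if i ≤ 2 ^ k then S + i * ((s - S) / 2 ^ k) else s + (i - 2 ^ k) * ((t - s) / 2 ^ k)
  have hπ₁ : ∀ k i, i ≤ 2 ^ k → π k i = S + i * ((s - S) / 2 ^ k) := fun k i hi => if_pos hi
  have hπ₂ : ∀ k i, π k (2 ^ k + i) = s + i * ((t - s) / 2 ^ k) := fun k i => by
    rcases Nat.eq_zero_or_pos i with rfl | hi
    · rw [add_zero, hπ₁ k _ le_rfl]
      push_cast; field_simp; ring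
    · have : ¬ 2 ^ k + i ≤ 2 ^ k := by lia
      simp only [π, if_neg this]
      push_cast; ring
  have hstep : ∀ k, ∀ i < 2 ^ k + 2 ^ k, π k (i + 1) - π k i = (s - S) / 2 ^ k ∨
      π k (i + 1) - π k i = (t - s) / 2 ^ k := fun k i _ => by
    rcases lt_or_ge i (2 ^ k) with h | h
    · left
      rw [hπ₁ k _ h.le, hπ₁ k _ h]
      push_cast; ring
    · right
      obtain ⟨j, rfl⟩ := Nat.exists_eq_add_of_le h
      rw [add_assoc, hπ₂, hπ₂]
      push_cast; ring
  have hboth := hlim t ⟨hs.le.trans hst.le, ht⟩ (fun k => 2 ^ k + 2 ^ k) π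
    (fun k => by rw [hπ₁ k 0 (Nat.zero_le _)]; simp)
    (fun k => by rw [hπ₂]; push_cast; field_simp; ring)
    (fun k i hi => by
      have h₁ : 0 < (s - S) / 2 ^ k := div_pos (by linarith) (by positivity)
      have h₂ : 0 < (t - s) / 2 ^ k := div_pos (by linarith) (by positivity)
      rcases hstep k i hi with h | h <;> linarith)
    (fun ε hε => by
      obtain ⟨K₁, hK₁⟩ := hmesh (s - S) ε hε
      obtain ⟨K₂, hK₂⟩ := hmesh (t - s) ε hε
      refine ⟨max K₁ K₂, fun k hk i hi => ?_⟩
      rcases hstep k i hi with h | h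
      · exact h.le.trans (hK₁ k ((le_max_left _ _).trans hk))
      · exact h.le.trans (hK₂ k ((le_max_right _ _).trans hk)))
  have hdiff := hboth.sub hleft
  rw [sub_sub_sub_cancel_right] at hdiff
  refine hdiff.congr fun k => ?_
  rw [Finset.sum_range_add, uniformRiemannSum, sub_eq_iff_eq_add']
  congr 1
  · refine Finset.sum_congr rfl fun i hi => ?_
    have hi := Finset.mem_range.1 hi
    rw [hπ₁ k _ hi.le, hπ₁ k _ hi]
  · refine Finset.sum_congr rfl fun i _ => ?_
    rw [add_assoc, hπ₂, hπ₂]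
    push_cast; rfl

/-- Halving the mesh of a uniform partition changes the Riemann sum by a power of the mesh. -/
theorem norm_uniformRiemannSum_sub_le {w : ℝ → ℝ → ℝ} {α β γ : ℝ} (hw : IsControl S T w)
    (hγ : 0 ≤ γ) (hγ' : γ ≤ 1) (hγα : γ ≤ α)
    (hA : ∀ s u t, S ≤ s → s ≤ u → u ≤ t → t ≤ T → S ≤ s - (t - s) →
      (t - s) / 3 ≤ u - s → (t - s) / 3 ≤ t - u →
      ‖A s t - A s u - A u t‖ ≤ w (s - (t - s)) t ^ α * (t - s) ^ β)
    {s t : ℝ} (hst : s ≤ t) (ht : t ≤ T) (hS : S ≤ s - (t - s)) {N : ℕ} (hN : 0 < N) :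
    ‖uniformRiemannSum A s t N - uniformRiemannSum A s t (2 * N)‖
      ≤ 2 * (w (s - (t - s)) t ^ α * (t - s) ^ β) * (N : ℝ) ^ (1 - γ - β) := by
  have hN' : (1 : ℝ) ≤ N := by exact_mod_cast hN
  set h : ℝ := (t - s) / N with hh
  have hh0 : 0 ≤ h := div_nonneg (by linarith) (by linarith)
  have hhN : N * h = t - s := by rw [hh]; field_simp
  have hhL : h ≤ t - s := by nlinarith
  let q : ℕ → ℝ := fun i => s + (i - 1) * h
  have hq : Monotone q := fun i j hij => by
    have : (i : ℝ) ≤ j := by exact_mod_cast hij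
    simp only [q]; nlinarith
  have hq0 : s - (t - s) ≤ q 0 := by simp only [q]; push_cast; linarith
  have hqN : q (N + 1) = t := by simp only [q]; push_cast; linarith
  have hqi : ∀ i < N, q (i + 2) ≤ t := fun i hi => hqN ▸ hq (by lia)
  have hqS : ∀ i, s - (t - s) ≤ q i := fun i => hq0.trans (hq (Nat.zero_le i))
  have hsum : ∑ i ∈ Finset.range N, w (q i) (q (i + 2)) ≤ 2 * w (s - (t - s)) t := by
    have h₁ := hw.sum_double_increment_le hq (hS.trans hq0) N (hqN.trans_le ht)
    have h₂ := hw.mono hS hq0 (hq (Nat.zero_le N)) (hqN ▸ hq (by lia)) ht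
    have h₃ := hw.mono hS hq0 (hq (Nat.zero_le (N + 1))) hqN.le ht
    linarith
  have hpow := sum_rpow_le_of_sum_le_two_mul hN hγ hγ' hγα
    (fun i hi => hw.nonneg (hS.trans (hqS i)) (hq (by lia)) ((hqi i hi).trans ht))
    (fun i hi => hw.mono hS (hqS i) (hq (by lia)) (hqi i hi) ht) hsum
  have hterm : ∀ i < N, ‖A (s + i * h) (s + (i + 1) * h)
      - (A (s + (2 * i : ℕ) * (h / 2)) (s + ((2 * i : ℕ) + 1) * (h / 2))
        + A (s + (2 * i + 1 : ℕ) * (h / 2)) (s + ((2 * i + 1 : ℕ) + 1) * (h / 2)))‖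
      ≤ w (q i) (q (i + 2)) ^ α * h ^ β := fun i hi => by
    have hqi := hqi i hi
    have hqS := hS.trans (hqS i)
    simp only [q] at hqi hqS ⊢
    push_cast at hqi hqS ⊢
    have hd := hA (s + i * h) (s + (2 * i + 1) * (h / 2)) (s + (i + 1) * h)
      (by linarith) (by linarith) (by linarith) (by linarith)
      (by linarith) (by linarith) (by linarith)
    convert hd using 2
    · rw [← sub_sub]
      congr 2 <;> congr 1 <;> ring
    · congr 2 <;> ring
    · congr 1; ring
  calc ‖uniformRiemannSum A s t N - uniformRiemannSum A s t (2 * N)‖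
      ≤ ∑ i ∈ Finset.range N, w (q i) (q (i + 2)) ^ α * h ^ β := by
        have hh2 : (t - s) / (2 * N : ℕ) = h / 2 := by rw [hh]; push_cast; field_simp
        rw [uniformRiemannSum, uniformRiemannSum, Finset.sum_range_two_mul_eq, ← hh, hh2,
          ← Finset.sum_sub_distrib]
        exact (norm_sum_le _ _).trans
          (Finset.sum_le_sum fun i hi => hterm i (Finset.mem_range.1 hi))
    _ ≤ 2 * (N : ℝ) ^ (1 - γ) * w (s - (t - s)) t ^ α * h ^ β := by
        rw [← Finset.sum_mul]
        exact mul_le_mul_of_nonneg_right hpow (Real.rpow_nonneg hh0 _)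
    _ = 2 * (w (s - (t - s)) t ^ α * (t - s) ^ β) * (N : ℝ) ^ (1 - γ - β) := by
        rw [hh, Real.div_rpow (by linarith) (by linarith), Real.rpow_sub (by linarith) (1 - γ)]
        ring

/-- A geometric-series bound for increments over `[s, t]`, given bounds on the right halves of
the intervals `[s, s + (t - s) / 2 ^ n]`. -/
theorem norm_sub_le_of_forall_right_half {s t B ρ : ℝ} (hst : s ≤ t) (hρ : ρ < 1)
    (hc : ContinuousOn 𝒜 (Set.Icc s t))
    (hB : ∀ n : ℕ, ‖𝒜 (s + (t - s) / 2 ^ n) - 𝒜 (s + (t - s) / 2 ^ (n + 1))‖ ≤ B * ρ ^ n) :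
    ‖𝒜 t - 𝒜 s‖ ≤ B / (1 - ρ) := by
  have hpts : Tendsto (fun n : ℕ => s + (t - s) / (2 : ℝ) ^ n) atTop
      (nhdsWithin s (Set.Icc s t)) := by
    refine tendsto_nhdsWithin_iff.2 ⟨?_, Eventually.of_forall fun n => ?_⟩
    · have h : Tendsto (fun k : ℕ => (t - s) / (2 : ℝ) ^ k) atTop (nhds 0) :=
        tendsto_const_nhds.div_atTop (tendsto_pow_atTop_atTop_of_one_lt (by norm_num))
      simpa using h.const_add s
    · have h₁ : 0 ≤ (t - s) / (2 : ℝ) ^ n := div_nonneg (by linarith) (by positivity)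
      have h₂ : (t - s) / (2 : ℝ) ^ n ≤ t - s :=
        div_le_self (by linarith) (one_le_pow₀ (by norm_num))
      constructor <;> linarith
  have := dist_le_of_le_geometric_of_tendsto₀ ρ B hρ (fun n => by
    rw [dist_eq_norm]; exact hB n) ((hc s ⟨le_rfl, hst⟩).tendsto.comp hpts)
  simpa [dist_eq_norm] using this

end

/-- Powers of dyadic fractions decay geometrically. -/
theorem div_two_pow_succ_rpow_le {L β δ : ℝ} (hL : 0 ≤ L) (hδ : 0 ≤ δ) (hδβ : δ ≤ β) (n : ℕ) :
    (L / 2 ^ (n + 1)) ^ β ≤ L ^ β * ((2 : ℝ) ^ (-δ)) ^ n := by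
  rw [Real.div_rpow hL (by positivity), div_eq_mul_inv, ← Real.rpow_neg (by positivity),
    ← Real.rpow_natCast, ← Real.rpow_natCast, ← Real.rpow_mul (by norm_num),
    ← Real.rpow_mul (by norm_num)]
  refine mul_le_mul_of_nonneg_left
    (Real.rpow_le_rpow_of_exponent_le (by norm_num) ?_) (Real.rpow_nonneg hL _)
  have hn : (0 : ℝ) ≤ n := n.cast_nonneg
  push_cast
  nlinarith

/-- Shifted deterministic sewing lemma. -/
theorem shifted_deterministic_sewing
    (α₁ α₂ β₁ β₂ : ℝ) (hα₁ : 0 ≤ α₁) (hα₂ : 0 ≤ α₂)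
    (hβ₁ : 0 < β₁) (hβ₂ : 0 < β₂) (hαβ : 1 < α₂ + β₂) :
    ∃ C₁ C₂ C₃ : ℝ, 0 < C₁ ∧ 0 < C₂ ∧ 0 < C₃ ∧
      ∀ (E : Type*) [NormedAddCommGroup E] [NormedSpace ℝ E] [CompleteSpace E]
        (S T : ℝ), S ≤ T →
        ∀ (A : ℝ → ℝ → E) (w₁ w₂ : ℝ → ℝ → ℝ),
        IsControl S T w₁ → IsControl S T w₂ →
        -- assumption (i): bound on increments on the shifted simplex
        (∀ s t, S ≤ s → s ≤ t → t ≤ T → S ≤ s - (t - s) →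
          ‖A s t‖ ≤ w₁ (s - (t - s)) t ^ α₁ * (t - s) ^ β₁) →
        -- assumption (ii): bound on the defect `δA` on the shifted simplex,
        -- for intermediate points in the middle-third regime
        (∀ s u t, S ≤ s → s ≤ u → u ≤ t → t ≤ T → S ≤ s - (t - s) →
          (t - s) / 3 ≤ u - s → (t - s) / 3 ≤ t - u →
          ‖A s t - A s u - A u t‖ ≤ w₂ (s - (t - s)) t ^ α₂ * (t - s) ^ β₂) →
        ∀ (𝒜 : ℝ → E), ContinuousOn 𝒜 (Set.Icc S T) →
        -- Riemann sums along any sequence of partitions of `[S, t]` with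
        -- vanishing mesh converge to `𝒜 t - 𝒜 S`
        (∀ t ∈ Set.Icc S T, ∀ (N : ℕ → ℕ) (π : ℕ → ℕ → ℝ),
          (∀ k, π k 0 = S) → (∀ k, π k (N k) = t) →
          (∀ k, ∀ i < N k, π k i < π k (i + 1)) →
          (∀ ε > (0:ℝ), ∃ K : ℕ, ∀ k ≥ K, ∀ i < N k, π k (i + 1) - π k i ≤ ε) →
          Tendsto (fun k => ∑ i ∈ Finset.range (N k), A (π k i) (π k (i + 1))) atTop
            (nhds (𝒜 t - 𝒜 S))) →
        -- conclusion (1)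
        (∀ s t, S ≤ s → s ≤ t → t ≤ T → S ≤ s - (t - s) →
          ‖𝒜 t - 𝒜 s - A s t‖ ≤ C₁ * (w₂ (s - (t - s)) t ^ α₂ * (t - s) ^ β₂)) ∧
        -- conclusion (2)
        (∀ s t, S ≤ s → s ≤ t → t ≤ T →
          ‖𝒜 t - 𝒜 s‖ ≤ C₂ * (w₁ s t ^ α₁ * (t - s) ^ β₁)
            + C₃ * (w₂ s t ^ α₂ * (t - s) ^ β₂)) := by
  set γ : ℝ := min α₂ 1
  have hγ : 0 ≤ γ := le_min hα₂ zero_le_one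
  have hγβ : 1 - γ - β₂ < 0 := by
    rcases min_cases α₂ (1 : ℝ) with h | h <;> simp only [γ, h.1] <;> linarith
  set δ : ℝ := min β₁ β₂
  have hδ : 0 < δ := lt_min hβ₁ hβ₂
  set r : ℝ := (2 : ℝ) ^ (1 - γ - β₂)
  have hr1 : r < 1 := Real.rpow_lt_one_of_one_lt_of_neg (by norm_num) hγβ
  set ρ : ℝ := (2 : ℝ) ^ (-δ)
  have hρ1 : ρ < 1 := Real.rpow_lt_one_of_one_lt_of_neg (by norm_num) (by linarith)
  have hC : 0 < 2 / (1 - r) := div_pos two_pos (by linarith)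
  refine ⟨2 / (1 - r), 1 / (1 - ρ), 2 / (1 - r) / (1 - ρ), hC, div_pos one_pos (by linarith),
    div_pos hC (by linarith), ?_⟩
  intro E _ _ _ S T _ A w₁ w₂ hw₁ hw₂ hA₁ hA₂ 𝒜 hc hlim
  have hone : ∀ s t, S ≤ s → s ≤ t → t ≤ T → S ≤ s - (t - s) →
      ‖𝒜 t - 𝒜 s - A s t‖ ≤ 2 / (1 - r) * (w₂ (s - (t - s)) t ^ α₂ * (t - s) ^ β₂) := by
    intro s t hs hst ht hS
    rcases hst.eq_or_lt with rfl | hlt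
    · have h := hA₁ s s hs le_rfl ht hS
      simp only [sub_self, Real.zero_rpow hβ₁.ne', mul_zero, norm_le_zero_iff] at h
      simp [h, Real.zero_rpow hβ₂.ne']
    have hconv := tendsto_uniformRiemannSum_two_pow hlim (by linarith : S < s) hlt ht
    have h := dist_le_of_le_geometric_of_tendsto₀ r
      (2 * (w₂ (s - (t - s)) t ^ α₂ * (t - s) ^ β₂)) hr1 (fun n => by
        have h := norm_uniformRiemannSum_sub_le hw₂ hγ (min_le_right _ _) (min_le_left _ _) hA₂
          hst ht hS (N := 2 ^ n) (by positivity)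
        rw [dist_eq_norm, pow_succ']
        refine h.trans_eq ?_
        congr 1
        push_cast
        rw [← Real.rpow_natCast, ← Real.rpow_natCast, ← Real.rpow_mul (by norm_num),
          ← Real.rpow_mul (by norm_num), mul_comm]) hconv
    rw [dist_comm, dist_eq_norm] at h
    have hA : uniformRiemannSum A s t (2 ^ 0) = A s t := by simp [uniformRiemannSum]
    rw [hA] at h
    exact h.trans_eq (by ring)
  refine ⟨hone, fun s t hs hst ht => ?_⟩
  have hL : 0 ≤ t - s := by linarith
  have hw₁0 := hw₁.nonneg hs hst ht
  have hw₂0 := hw₂.nonneg hs hst ht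
  refine (norm_sub_le_of_forall_right_half (ρ := ρ) (B := w₁ s t ^ α₁ * (t - s) ^ β₁
    + 2 / (1 - r) * (w₂ s t ^ α₂ * (t - s) ^ β₂)) hst hρ1
    (hc.mono (Set.Icc_subset_Icc hs ht)) fun n => ?_).trans_eq (by ring)
  set h : ℝ := (t - s) / 2 ^ (n + 1) with hh
  have hh0 : 0 ≤ h := div_nonneg hL (by positivity)
  have h2h : (t - s) / 2 ^ n = 2 * h := by rw [hh, pow_succ]; field_simp
  have h2hL : 2 * h ≤ t - s := h2h ▸ div_le_self hL (one_le_pow₀ (by norm_num))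
  have hlen : s + 2 * h - (s + h) = h := by ring
  have hshift : s + h - h = s := by ring
  have hinc := hA₁ (s + h) (s + 2 * h) (by linarith) (by linarith) (by linarith)
    (by linarith)
  have hrem := hone (s + h) (s + 2 * h) (by linarith) (by linarith) (by linarith)
    (by linarith)
  rw [hlen, hshift] at hinc hrem
  have hv₁ := hw₁.nonneg hs (by linarith : s ≤ s + 2 * h) (by linarith)
  have hv₂ := hw₂.nonneg hs (by linarith : s ≤ s + 2 * h) (by linarith)
  have hm₁ := hw₁.mono hs le_rfl (by linarith : s ≤ s + 2 * h) (by linarith) ht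
  have hm₂ := hw₂.mono hs le_rfl (by linarith : s ≤ s + 2 * h) (by linarith) ht
  have hd₁ : h ^ β₁ ≤ (t - s) ^ β₁ * ρ ^ n :=
    div_two_pow_succ_rpow_le hL hδ.le (min_le_left _ _) n
  have hd₂ : h ^ β₂ ≤ (t - s) ^ β₂ * ρ ^ n :=
    div_two_pow_succ_rpow_le hL hδ.le (min_le_right _ _) n
  rw [h2h]
  calc ‖𝒜 (s + 2 * h) - 𝒜 (s + h)‖
      ≤ ‖A (s + h) (s + 2 * h)‖ + ‖𝒜 (s + 2 * h) - 𝒜 (s + h) - A (s + h) (s + 2 * h)‖ :=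
        norm_le_norm_add_norm_sub' _ _
    _ ≤ w₁ s (s + 2 * h) ^ α₁ * h ^ β₁ + 2 / (1 - r) * (w₂ s (s + 2 * h) ^ α₂ * h ^ β₂) :=
        add_le_add hinc hrem
    _ ≤ w₁ s t ^ α₁ * ((t - s) ^ β₁ * ρ ^ n)
          + 2 / (1 - r) * (w₂ s t ^ α₂ * ((t - s) ^ β₂ * ρ ^ n)) := by
        gcongr
    _ = _ := by ring
end

section
/- Let T > 0, let 0 ≤ ξ ≤ t ≤ T, and let f, g : [0,T] → ℝ be measurable and square integrable on [0,T], with ∫_t^T g(u)² du > 0. For s ∈ [ξ,t] define ĥ(s) = g(s) · (∫_s^t f(r) g(r) dr) / (∫_s^T g(u)² du). Then the following exact identity holds: ∫_ξ^t (f(s) − ĥ(s))² ds = ∫_ξ^t f(s)² ds − (∫_ξ^t f(r) g(r) dr)² / (∫_ξ^T g(u)² du). -/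
open MeasureTheory intervalIntegral

/-- The inverse of an absolutely continuous real function that is bounded away from zero is
absolutely continuous. -/
theorem AbsolutelyContinuousOnInterval.inv_of_le {f : ℝ → ℝ} {a b c : ℝ}
    (hf : AbsolutelyContinuousOnInterval f a b) (hc : 0 < c)
    (hfc : ∀ x ∈ Set.uIcc a b, c ≤ f x) :
    AbsolutelyContinuousOnInterval (fun x => (f x)⁻¹) a b := by
  have hf' := hf.const_mul ((c * c)⁻¹)
  unfold AbsolutelyContinuousOnInterval at hf' ⊢
  refine squeeze_zero' (Filter.Eventually.of_forall fun _ =>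
    Finset.sum_nonneg fun _ _ => dist_nonneg) ?_ hf'
  rw [Filter.eventually_inf_principal]
  refine Filter.Eventually.of_forall fun E hE => Finset.sum_le_sum fun i hi => ?_
  have h₁ := hfc _ (hE.1 i hi).1
  have h₂ := hfc _ (hE.1 i hi).2
  have p₁ := hc.trans_le h₁
  have p₂ := hc.trans_le h₂
  rw [dist_inv_inv₀ p₁.ne' p₂.ne', Real.dist_eq, Real.dist_eq, ← mul_sub, abs_mul,
    abs_of_pos (by positivity : 0 < (c * c)⁻¹), Real.norm_of_nonneg p₁.le,
    Real.norm_of_nonneg p₂.le, div_eq_inv_mul]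
  gcongr

/-- The product of two measurable functions with interval integrable squares is interval
integrable. -/
theorem intervalIntegrable_mul_of_sq {f g : ℝ → ℝ} {a b : ℝ} (hf : Measurable f)
    (hg : Measurable g) (hf2 : IntervalIntegrable (fun x => f x ^ 2) volume a b)
    (hg2 : IntervalIntegrable (fun x => g x ^ 2) volume a b) :
    IntervalIntegrable (fun x => f x * g x) volume a b := by
  refine (hf2.add hg2).mono_fun (hf.mul hg).aestronglyMeasurable
    (Filter.Eventually.of_forall fun x => ?_)
  simp only [Real.norm_eq_abs]
  rw [abs_of_nonneg (by positivity : 0 ≤ f x ^ 2 + g x ^ 2), abs_le]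
  constructor <;> nlinarith [sq_nonneg (f x + g x), sq_nonneg (f x - g x)]

/-- Exact identity for the conditional variance of a Gaussian–Volterra bridge:
if `f, g` are measurable and square integrable on `[0, T]`, `0 ≤ ξ ≤ t ≤ T` and
`∫_t^T g² > 0`, then with `ĥ(s) = g(s) (∫_s^t f g) / (∫_s^T g²)` one has
`∫_ξ^t (f - ĥ)² = ∫_ξ^t f² - (∫_ξ^t f g)² / (∫_ξ^T g²)`. -/
theorem bridge_variance_identity
    (T : ℝ) (hT : 0 < T) (ξ t : ℝ) (hξ : 0 ≤ ξ) (hξt : ξ ≤ t) (htT : t ≤ T)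
    (f g : ℝ → ℝ) (hf : Measurable f) (hg : Measurable g)
    (hf2 : IntervalIntegrable (fun x => (f x) ^ 2) volume 0 T)
    (hg2 : IntervalIntegrable (fun x => (g x) ^ 2) volume 0 T)
    (hpos : 0 < ∫ u in t..T, (g u) ^ 2) :
    (∫ s in ξ..t,
        (f s - g s * (∫ r in s..t, f r * g r) / (∫ u in s..T, (g u) ^ 2)) ^ 2)
      = (∫ s in ξ..t, (f s) ^ 2)
        - (∫ r in ξ..t, f r * g r) ^ 2 / (∫ u in ξ..T, (g u) ^ 2) := by
  have hsub : Set.uIcc ξ T ⊆ Set.uIcc 0 T := by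
    rw [Set.uIcc_of_le (hξt.trans htT), Set.uIcc_of_le hT.le]
    exact Set.Icc_subset_Icc_left hξ
  have hsub' : Set.uIcc ξ t ⊆ Set.uIcc ξ T := by
    rw [Set.uIcc_of_le (hξt.trans htT), Set.uIcc_of_le hξt]
    exact Set.Icc_subset_Icc_right htT
  have hg2T : IntervalIntegrable (fun x => g x ^ 2) volume ξ T := hg2.mono_set hsub
  have hf2t : IntervalIntegrable (fun x => f x ^ 2) volume ξ t :=
    hf2.mono_set (hsub'.trans hsub)
  have hfg : IntervalIntegrable (fun x => f x * g x) volume ξ t :=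
    (intervalIntegrable_mul_of_sq hf hg hf2 hg2).mono_set (hsub'.trans hsub)
  set A : ℝ → ℝ := fun s => ∫ r in s..t, f r * g r with hA
  set B : ℝ → ℝ := fun s => ∫ u in s..T, g u ^ 2 with hB
  have hA_neg : A = fun s => -∫ r in t..s, f r * g r :=
    funext fun s => integral_symm t s
  have hB_neg : B = fun s => -∫ u in T..s, g u ^ 2 :=
    funext fun s => integral_symm T s
  have hA_ac : AbsolutelyContinuousOnInterval A ξ t := by
    rw [hA_neg]
    exact (hfg.absolutelyContinuousOnInterval_intervalIntegral Set.right_mem_uIcc).fun_neg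
  have hB_ac : AbsolutelyContinuousOnInterval B ξ t := by
    rw [hB_neg]
    exact ((hg2T.absolutelyContinuousOnInterval_intervalIntegral
      Set.right_mem_uIcc).mono hsub').fun_neg
  have hB_le : ∀ s ∈ Set.uIcc ξ t, B t ≤ B s := by
    intro s hs
    have hsT := hsub' hs
    rw [Set.uIcc_of_le hξt] at hs
    exact integral_mono_interval hs.2 htT le_rfl
      (Filter.Eventually.of_forall fun x => sq_nonneg (g x))
      (hg2T.mono_set (Set.uIcc_subset_uIcc hsT Set.right_mem_uIcc))
  have hH_ac : AbsolutelyContinuousOnInterval (fun s => A s * A s * (B s)⁻¹) ξ t :=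
    (hA_ac.fun_mul hA_ac).fun_mul (hB_ac.inv_of_le hpos hB_le)
  have hderiv : ∀ᵐ s, s ∈ Set.uIoc ξ t →
      (f s - g s * A s / B s) ^ 2 = f s ^ 2 + deriv (fun s => A s * A s * (B s)⁻¹) s := by
    filter_upwards [hfg.ae_hasDerivAt_integral, hg2T.ae_hasDerivAt_integral] with s hs₁ hs₂ hs
    have hs' := Set.uIoc_subset_uIcc hs
    have hBs : B s ≠ 0 := (hpos.trans_le (hB_le s hs')).ne'
    have dA : HasDerivAt A (-(f s * g s)) s := by
      rw [hA_neg]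
      exact (hs₁ hs' t Set.right_mem_uIcc).fun_neg
    have dB : HasDerivAt B (-(g s ^ 2)) s := by
      rw [hB_neg]
      exact (hs₂ (hsub' hs') T Set.right_mem_uIcc).fun_neg
    rw [((dA.fun_mul dA).fun_mul (dB.fun_inv hBs)).deriv]
    field_simp
    ring
  have hAt : A t = 0 := integral_same
  calc ∫ s in ξ..t, (f s - g s * A s / B s) ^ 2
      = ∫ s in ξ..t, (f s ^ 2 + deriv (fun s => A s * A s * (B s)⁻¹) s) :=
        integral_congr_ae hderiv
    _ = (∫ s in ξ..t, f s ^ 2) - A ξ ^ 2 / B ξ := by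
        rw [integral_add hf2t hH_ac.intervalIntegrable_deriv, hH_ac.integral_deriv_eq_sub, hAt]
        ring
end
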